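/- In any initial branching process (N^U, λ) of a bounded, finite Petri net N, the cuts of N^U are exactly its reachable markings. -/

import Mathlib

/-- A Petri net over places `P` and transitions `T`: each transition has a
nonempty finite multiset precondition and postcondition (encoding the flow
relation `F`), and there is a finite initial marking. -/
structure PetriNet (P T : Type) where
  pre  : T → Multiset P
  post : T → Multiset P
  init : Multiset P
  pre_ne  : ∀ t, pre t ≠ 0
  post_ne : ∀ t, post t ≠ 0

namespace PetriNet

variable {P T : Type}

/-- A transition `t` is enabled in a marking `M` if `pre t ⊆ M`. -/
def Enabled (N : PetriNet P T) (M : Multiset P) (t : T) : Prop :=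
  N.pre t ≤ M

/-- `M →t M'`: firing an enabled transition. -/
def Fires [DecidableEq P] (N : PetriNet P T) (M : Multiset P) (t : T) (M' : Multiset P) : Prop :=
  N.pre t ≤ M ∧ M' = M - N.pre t + N.post t

def Step [DecidableEq P] (N : PetriNet P T) (M M' : Multiset P) : Prop :=
  ∃ t, N.Fires M t M'

/-- A marking is reachable if obtained from the initial marking by firing a
finite sequence of transitions. -/
def Reachable [DecidableEq P] (N : PetriNet P T) (M : Multiset P) : Prop :=
  Relation.ReflTransGen N.Step N.init M

/-- The flow relation on nodes (places ⊕ transitions). -/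
def Flow (N : PetriNet P T) : P ⊕ T → P ⊕ T → Prop
  | Sum.inl p, Sum.inr t => p ∈ N.pre t
  | Sum.inr t, Sum.inl p => p ∈ N.post t
  | _, _ => False

/-- `<` : transitive closure of the flow relation. -/
def CLt (N : PetriNet P T) : P ⊕ T → P ⊕ T → Prop := Relation.TransGen N.Flow

/-- `≤` : reflexive-transitive closure of the flow relation. -/
def CLe (N : PetriNet P T) : P ⊕ T → P ⊕ T → Prop := Relation.ReflTransGen N.Flow

/-- Nodes `x`, `y` are in conflict if from some place `q` (distinct from both)
one can reach `x` and `y` via two different outgoing transitions of `q`. -/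
def Conflict (N : PetriNet P T) (x y : P ⊕ T) : Prop :=
  ∃ q : P, Sum.inl q ≠ x ∧ Sum.inl q ≠ y ∧
    ∃ t₁ t₂ : T, t₁ ≠ t₂ ∧ q ∈ N.pre t₁ ∧ q ∈ N.pre t₂ ∧
      N.CLe (Sum.inr t₁) x ∧ N.CLe (Sum.inr t₂) y

/-- Concurrent: neither causally related nor in conflict. -/
def Concurrent (N : PetriNet P T) (x y : P ⊕ T) : Prop :=
  ¬ N.CLe x y ∧ ¬ N.CLe y x ∧ ¬ N.Conflict x y

/-- Occurrence net: pre/postconditions are sets, every place has at most one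
incoming transition, the initial marking is the set of places without incoming
transitions, the inverse flow relation is well-founded, and no transition is in
self-conflict. -/
structure IsOccurrence (N : PetriNet P T) : Prop where
  pre_nodup : ∀ t, (N.pre t).Nodup
  post_nodup : ∀ t, (N.post t).Nodup
  unique_pre : ∀ p : P, ∀ t₁ t₂ : T, p ∈ N.post t₁ → p ∈ N.post t₂ → t₁ = t₂
  init_nodup : N.init.Nodup
  mem_init : ∀ p : P, p ∈ N.init ↔ ∀ t : T, p ∉ N.post t
  wf : WellFounded N.Flow
  no_self_conflict : ∀ t : T, ¬ N.Conflict (Sum.inr t) (Sum.inr t)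

def PairwiseConcurrent (N : PetriNet P T) (C : Set P) : Prop :=
  ∀ p ∈ C, ∀ q ∈ C, p ≠ q → N.Concurrent (Sum.inl p) (Sum.inl q)

/-- A cut: a maximal set of pairwise concurrent places. -/
def IsCut (N : PetriNet P T) (C : Set P) : Prop :=
  N.PairwiseConcurrent C ∧ ∀ D : Set P, N.PairwiseConcurrent D → C ⊆ D → D = C

end PetriNet

/-- `(N₁, fP, fT)` is an initial branching process of `N₂`: `N₁` is an
occurrence net, `(fP, fT)` is an initial homomorphism, and transitions with the
same precondition and the same image coincide. -/
structure IsBranchingProcess {P₁ T₁ P₂ T₂ : Type}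
    (N₁ : PetriNet P₁ T₁) (N₂ : PetriNet P₂ T₂)
    (fP : P₁ → P₂) (fT : T₁ → T₂) : Prop where
  occ : N₁.IsOccurrence
  map_pre : ∀ t, (N₁.pre t).map fP = N₂.pre (fT t)
  map_post : ∀ t, (N₁.post t).map fP = N₂.post (fT t)
  map_init : N₁.init.map fP = N₂.init
  trans_inj : ∀ t₁ t₂, N₁.pre t₁ = N₁.pre t₂ → fT t₁ = fT t₂ → t₁ = t₂


namespace PetriNet

variable {P T : Type} {N : PetriNet P T}

/-- `N.Configuration K M`: `K` is a causally closed, conflict-free set of transitions, and `M` is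
the marking left after firing all of `K`. -/
structure Configuration (N : PetriNet P T) (K : Set T) (M : Multiset P) : Prop where
  closed : ∀ t ∈ K, ∀ p ∈ N.pre t, ∀ u, p ∈ N.post u → u ∈ K
  conflict_free : ∀ t ∈ K, ∀ u ∈ K, ∀ p ∈ N.pre t, p ∈ N.pre u → t = u
  nodup : M.Nodup
  mem_iff : ∀ p, p ∈ M ↔ (∀ t, p ∈ N.post t → t ∈ K) ∧ ∀ t, p ∈ N.pre t → t ∉ K
  cofinal : ∀ p, (∀ t, p ∈ N.post t → t ∈ K) → ∃ c ∈ M, N.CLe (Sum.inl p) (Sum.inl c)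

theorem cLe_inl_inr {p : P} {t : T} (h : p ∈ N.pre t) : N.CLe (Sum.inl p) (Sum.inr t) :=
  Relation.ReflTransGen.single h

theorem cLe_inr_inl {p : P} {t : T} (h : p ∈ N.post t) : N.CLe (Sum.inr t) (Sum.inl p) :=
  Relation.ReflTransGen.single h

theorem exists_consumer_of_cLe {p : P} {x : P ⊕ T} (h : N.CLe (Sum.inl p) x)
    (hne : Sum.inl p ≠ x) : ∃ t, p ∈ N.pre t ∧ N.CLe (Sum.inr t) x := by
  rcases Relation.ReflTransGen.cases_head h with h | ⟨y, hy, h⟩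
  · exact absurd h hne
  · cases y with
    | inl q => exact hy.elim
    | inr t => exact ⟨t, hy, h⟩

theorem exists_producer_of_cLe {t : T} {p : P} (h : N.CLe (Sum.inr t) (Sum.inl p)) :
    ∃ u, p ∈ N.post u ∧ N.CLe (Sum.inr t) (Sum.inr u) := by
  rcases Relation.ReflTransGen.cases_tail h with h | ⟨y, h, hy⟩
  · cases h
  · cases y with
    | inl q => exact hy.elim
    | inr u => exact ⟨u, hy, h⟩

namespace IsOccurrence

theorem cLt_irrefl (hN : N.IsOccurrence) (x : P ⊕ T) : ¬ N.CLt x x :=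
  fun h => hN.wf.transGen.irrefl.irrefl x h

theorem ne_of_mem_pre_of_cLe (hN : N.IsOccurrence) {p : P} {t : T} {x : P ⊕ T}
    (hp : p ∈ N.pre t) (h : N.CLe (Sum.inr t) x) : Sum.inl p ≠ x := by
  rintro rfl
  exact hN.cLt_irrefl _ (Relation.TransGen.head' (show N.Flow (.inl p) (.inr t) from hp) h)

theorem not_mem_post_of_mem_pre (hN : N.IsOccurrence) {p : P} {t : T} (hp : p ∈ N.pre t) :
    p ∉ N.post t :=
  fun h => hN.ne_of_mem_pre_of_cLe hp (cLe_inr_inl h) rfl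

theorem not_conflict_inl_self (hN : N.IsOccurrence) (p : P) :
    ¬ N.Conflict (Sum.inl p) (Sum.inl p) := by
  rintro ⟨q, -, -, t, u, htu, ht, hu, htp, hup⟩
  obtain ⟨v, hv, htv⟩ := exists_producer_of_cLe htp
  obtain ⟨w, hw, huw⟩ := exists_producer_of_cLe hup
  obtain rfl := hN.unique_pre p v w hv hw
  exact hN.no_self_conflict v ⟨q, by simp, by simp, t, u, htu, ht, hu, htv, huw⟩

theorem finite_past (hN : N.IsOccurrence) (x : P ⊕ T) :
    {t : T | N.CLe (Sum.inr t) x}.Finite := by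
  induction x using hN.wf.induction with
  | h x ih =>
    cases x with
    | inl p =>
      by_cases h : ∃ u, p ∈ N.post u
      · obtain ⟨u, hu⟩ := h
        refine (ih (.inr u) hu).subset fun t ht => ?_
        obtain ⟨v, hv, htv⟩ := exists_producer_of_cLe ht
        obtain rfl := hN.unique_pre p u v hu hv
        exact htv
      · refine Set.finite_empty.subset fun t ht => ?_
        obtain ⟨v, hv, -⟩ := exists_producer_of_cLe ht
        exact h ⟨v, hv⟩
    | inr u =>
      have hfin : (⋃ p ∈ {p | p ∈ N.pre u}, {t : T | N.CLe (Sum.inr t) (Sum.inl p)}).Finite := by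
        classical
        refine Set.Finite.biUnion ?_ fun p hp => ih (.inl p) hp
        exact (N.pre u).toFinset.finite_toSet.subset fun p hp => by simpa using hp
      refine (hfin.insert u).subset fun t ht => ?_
      rcases Relation.ReflTransGen.cases_tail ht with h | ⟨y, h, hy⟩
      · left
        simpa using h.symm
      · right
        cases y with
        | inl q => exact Set.mem_biUnion (show q ∈ {p | p ∈ N.pre u} from hy) h
        | inr v => exact hy.elim

theorem configuration_empty (hN : N.IsOccurrence) : N.Configuration ∅ N.init where
  closed := by simp
  conflict_free := by simp
  nodup := hN.init_nodup
  mem_iff p := by simp [hN.mem_init]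
  cofinal p hp := ⟨p, (hN.mem_init p).2 hp, .refl⟩

end IsOccurrence

namespace Configuration

variable {K : Set T} {M : Multiset P}

theorem mem_of_cLe_inr (h : N.Configuration K M) {x : P ⊕ T} {t : T} (hxt : N.CLe x (Sum.inr t))
    (ht : t ∈ K) :
    Sum.elim (fun p => ∀ u, p ∈ N.post u → u ∈ K) (· ∈ K) x := by
  induction hxt using Relation.ReflTransGen.head_induction_on with
  | refl => exact ht
  | @head y z hyz _ ih =>
    cases y <;> cases z
    · exact hyz.elim
    · exact h.closed _ ih _ hyz
    · exact ih _ hyz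
    · exact hyz.elim

theorem mem_of_cLe_inl (h : N.Configuration K M) {t : T} {p : P}
    (htp : N.CLe (Sum.inr t) (Sum.inl p)) (hp : ∀ u, p ∈ N.post u → u ∈ K) : t ∈ K := by
  obtain ⟨u, hu, htu⟩ := exists_producer_of_cLe htp
  exact h.mem_of_cLe_inr htu (hp u hu)

theorem fire [DecidableEq P] (h : N.Configuration K M) (hN : N.IsOccurrence) {t : T}
    (ht : N.pre t ≤ M) : N.Configuration (insert t K) (M - N.pre t + N.post t) := by
  have hpre : ∀ p ∈ N.pre t, p ∈ M := fun p hp => Multiset.mem_of_le ht hp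
  have htK : t ∉ K := by
    obtain ⟨p, hp⟩ := Multiset.exists_mem_of_ne_zero (N.pre_ne t)
    exact ((h.mem_iff p).1 (hpre p hp)).2 t hp
  have hpost : ∀ p ∈ N.post t, p ∉ M := fun p hp hpM => htK (((h.mem_iff p).1 hpM).1 t hp)
  have hsub : ∀ p, p ∈ M - N.pre t ↔ p ∈ M ∧ p ∉ N.pre t := fun p =>
    Multiset.mem_sub_of_nodup h.nodup
  have hmem : ∀ p, p ∈ M - N.pre t + N.post t ↔ (p ∈ M ∧ p ∉ N.pre t) ∨ p ∈ N.post t := fun p => by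
    rw [Multiset.mem_add, hsub]
  refine ⟨?_, ?_, ?_, ?_, ?_⟩
  · rintro u (rfl | hu) p hp v hv
    · exact .inr (((h.mem_iff p).1 (hpre p hp)).1 v hv)
    · exact .inr (h.closed u hu p hp v hv)
  · rintro u (rfl | hu) v (rfl | hv) p hpu hpv
    · rfl
    · exact absurd hv (((h.mem_iff p).1 (hpre p hpu)).2 v hpv)
    · exact absurd hu (((h.mem_iff p).1 (hpre p hpv)).2 u hpu)
    · exact h.conflict_free u hu v hv p hpu hpv
  · refine Multiset.nodup_add.2 ⟨Multiset.nodup_of_le tsub_le_self h.nodup, hN.post_nodup t, ?_⟩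
    rw [Multiset.disjoint_left]
    exact fun hp hp' => hpost _ hp' ((hsub _).1 hp).1
  · intro p
    rw [hmem]
    constructor
    · rintro (⟨hpM, hpt⟩ | hp)
      · obtain ⟨h1, h2⟩ := (h.mem_iff p).1 hpM
        refine ⟨fun u hu => .inr (h1 u hu), ?_⟩
        rintro u hu (rfl | huK)
        · exact hpt hu
        · exact h2 u hu huK
      · refine ⟨fun u hu => .inl (hN.unique_pre p u t hu hp), ?_⟩
        rintro u hu (rfl | huK)
        · exact hN.not_mem_post_of_mem_pre hu hp
        · exact htK (h.closed u huK p hu t hp)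
    · rintro ⟨h1, h2⟩
      by_cases hp : p ∈ N.post t
      · exact .inr hp
      · refine .inl ⟨(h.mem_iff p).2 ⟨fun u hu => ?_, fun u hu huK => h2 u hu (.inr huK)⟩,
          fun hpt => h2 t hpt (.inl rfl)⟩
        rcases h1 u hu with rfl | huK
        · exact absurd hu hp
        · exact huK
  · intro p hprod
    by_cases hp : p ∈ N.post t
    · exact ⟨p, (hmem p).2 (.inr hp), .refl⟩
    · obtain ⟨c, hc, hpc⟩ := h.cofinal p fun u hu => by
        rcases hprod u hu with rfl | huK
        · exact absurd hu hp
        · exact huK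
      by_cases hct : c ∈ N.pre t
      · obtain ⟨d, hd⟩ := Multiset.exists_mem_of_ne_zero (N.post_ne t)
        exact ⟨d, (hmem d).2 (.inr hd), (hpc.trans (cLe_inl_inr hct)).trans (cLe_inr_inl hd)⟩
      · exact ⟨c, (hmem c).2 (.inl ⟨hc, hct⟩), hpc⟩

theorem exists_cLe_mem (h : N.Configuration K M) (hN : N.IsOccurrence) {t : T} (ht : t ∈ K) :
    ∃ c ∈ M, N.CLe (Sum.inr t) (Sum.inl c) := by
  obtain ⟨d, hd⟩ := Multiset.exists_mem_of_ne_zero (N.post_ne t)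
  obtain ⟨c, hc, hdc⟩ := h.cofinal d fun u hu => by rwa [hN.unique_pre d u t hu hd]
  exact ⟨c, hc, (cLe_inr_inl hd).trans hdc⟩

theorem pairwiseConcurrent (h : N.Configuration K M) : N.PairwiseConcurrent {p | p ∈ M} := by
  have hle : ∀ p ∈ M, ∀ q ∈ M, p ≠ q → ¬ N.CLe (Sum.inl p) (Sum.inl q) := by
    intro p hp q hq hpq hle
    obtain ⟨t, ht, htq⟩ := exists_consumer_of_cLe hle (by simpa using hpq)
    exact ((h.mem_iff p).1 hp).2 t ht (h.mem_of_cLe_inl htq ((h.mem_iff q).1 hq).1)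
  intro p hp q hq hpq
  refine ⟨hle p hp q hq hpq, hle q hq p hp hpq.symm, ?_⟩
  rintro ⟨r, -, -, t, u, htu, ht, hu, htp, huq⟩
  exact htu (h.conflict_free t (h.mem_of_cLe_inl htp ((h.mem_iff p).1 hp).1)
    u (h.mem_of_cLe_inl huq ((h.mem_iff q).1 hq).1) r ht hu)

theorem isCut (h : N.Configuration K M) (hN : N.IsOccurrence) : N.IsCut {p | p ∈ M} := by
  refine ⟨h.pairwiseConcurrent, fun D hD hMD => (Set.Subset.antisymm hMD fun d hd => ?_).symm⟩
  refine (h.mem_iff d).2 ⟨fun u hu => ?_, fun u hu huK => ?_⟩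
  · by_contra huK
    let S : Set (P ⊕ T) := {x | ∃ t, x = Sum.inr t ∧ t ∉ K ∧ N.CLe (Sum.inr t) (Sum.inl d)}
    obtain ⟨_, ⟨t, rfl, htK, htd⟩, hmin⟩ :=
      hN.wf.transGen.has_min S ⟨_, u, rfl, huK, cLe_inr_inl hu⟩
    obtain ⟨p, hp⟩ := Multiset.exists_mem_of_ne_zero (N.pre_ne t)
    have hprod : ∀ v, p ∈ N.post v → v ∈ K := fun v hv => by
      by_contra hvK
      exact hmin (.inr v)
        ⟨v, rfl, hvK, ((cLe_inr_inl hv).trans (cLe_inl_inr hp)).trans htd⟩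
        (.tail (.single (show N.Flow (.inr v) (.inl p) from hv)) hp)
    have hpd : Sum.inl p ≠ (Sum.inl d : P ⊕ T) := hN.ne_of_mem_pre_of_cLe hp htd
    by_cases hcons : ∃ v ∈ K, p ∈ N.pre v
    · obtain ⟨v, hvK, hpv⟩ := hcons
      obtain ⟨c, hc, hvc⟩ := h.exists_cLe_mem hN hvK
      have hcd : c ≠ d := by
        rintro rfl
        exact htK (h.mem_of_cLe_inl htd ((h.mem_iff c).1 hc).1)
      exact (hD c (hMD hc) d hd hcd).2.2 ⟨p, hN.ne_of_mem_pre_of_cLe hpv hvc, hpd, v, t,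
        fun hvt => htK (hvt ▸ hvK), hpv, hp, hvc, htd⟩
    · have hpM : p ∈ M := (h.mem_iff p).2 ⟨hprod, fun v hv hvK => hcons ⟨v, hvK, hv⟩⟩
      exact (hD p (hMD hpM) d hd fun hpd' => hpd (by rw [hpd'])).1 ((cLe_inl_inr hp).trans htd)
  · obtain ⟨c, hc, huc⟩ := h.exists_cLe_mem hN huK
    have hdc : d ≠ c := fun hdc => hN.ne_of_mem_pre_of_cLe hu huc (by rw [hdc])
    exact (hD d hd c (hMD hc) hdc).1 ((cLe_inl_inr hu).trans huc)

end Configuration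

namespace IsOccurrence

theorem exists_configuration [DecidableEq P] (hN : N.IsOccurrence) {M : Multiset P}
    (hM : N.Reachable M) : ∃ K, N.Configuration K M := by
  induction hM with
  | refl => exact ⟨∅, hN.configuration_empty⟩
  | tail _ hstep ih =>
    obtain ⟨K, hK⟩ := ih
    obtain ⟨t, ht, rfl⟩ := hstep
    exact ⟨_, hK.fire hN ht⟩

/-- A finite, causally closed, conflict-free set of transitions can be fired completely. -/
theorem exists_reachable [DecidableEq P] (hN : N.IsOccurrence) {K : Set T} (hfin : K.Finite)
    (hclosed : ∀ t ∈ K, ∀ p ∈ N.pre t, ∀ u, p ∈ N.post u → u ∈ K)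
    (hcf : ∀ t ∈ K, ∀ u ∈ K, ∀ p ∈ N.pre t, p ∈ N.pre u → t = u) :
    ∃ M, N.Reachable M ∧ N.Configuration K M := by
  suffices H : ∀ n : ℕ, ∀ L ⊆ K, ∀ M, N.Reachable M → N.Configuration L M → (K \ L).ncard = n →
      ∃ M, N.Reachable M ∧ N.Configuration K M from
    H _ ∅ (Set.empty_subset K) N.init .refl hN.configuration_empty rfl
  intro n
  induction n with
  | zero =>
    intro L hLK M hM hL hcard
    have hKL : K ⊆ L := Set.sdiff_eq_empty.1 ((Set.ncard_eq_zero hfin.sdiff).1 hcard)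
    obtain rfl := hLK.antisymm hKL
    exact ⟨M, hM, hL⟩
  | succ n ih =>
    intro L hLK M hM hL hcard
    obtain ⟨s, hs⟩ : (K \ L).Nonempty := Set.nonempty_of_ncard_ne_zero (by omega)
    obtain ⟨_, ⟨t, ⟨htK, htL⟩, rfl⟩, hmin⟩ :=
      hN.wf.transGen.has_min (Sum.inr '' (K \ L)) ⟨_, s, hs, rfl⟩
    have hen : N.pre t ≤ M := by
      refine (Multiset.le_iff_subset (hN.pre_nodup t)).2 fun p hp => (hL.mem_iff p).2
        ⟨fun u hu => ?_, fun u hu huL => htL ?_⟩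
      · by_contra huL
        exact hmin (.inr u) ⟨u, ⟨hclosed t htK p hp u hu, huL⟩, rfl⟩
          (.tail (.single (show N.Flow (.inr u) (.inl p) from hu)) hp)
      · rwa [hcf t htK u (hLK huL) p hp hu]
    refine ih (insert t L) (Set.insert_subset htK hLK) _ (hM.tail ⟨t, hen, rfl⟩)
      (hL.fire hN hen) ?_
    have hdiff : K \ insert t L = (K \ L) \ {t} := by
      ext u
      simp only [Set.mem_sdiff, Set.mem_insert_iff, Set.mem_singleton_iff]
      tauto
    rw [hdiff, Set.ncard_sdiff_singleton_of_mem (Set.mem_sdiff_of_mem htK htL), hcard, Nat.add_sub_cancel]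

theorem exists_reachable_superset [DecidableEq P] (hN : N.IsOccurrence) {C : Set P}
    (hfin : C.Finite) (hC : N.PairwiseConcurrent C) :
    ∃ M, N.Reachable M ∧ C ⊆ {p | p ∈ M} := by
  obtain ⟨M, hM, hK⟩ := hN.exists_reachable
    (K := {t | ∃ c ∈ C, N.CLe (Sum.inr t) (Sum.inl c)})
    ((hfin.biUnion fun c _ => hN.finite_past (.inl c)).subset
      fun t ⟨c, hc, htc⟩ => Set.mem_biUnion hc htc)
    (fun t ⟨c, hc, htc⟩ p hp u hu =>
      ⟨c, hc, ((cLe_inr_inl hu).trans (cLe_inl_inr hp)).trans htc⟩)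
    (by
      rintro t ⟨c, hc, htc⟩ u ⟨d, hd, hud⟩ p hpt hpu
      by_contra htu
      have hconf : N.Conflict (Sum.inl c) (Sum.inl d) :=
        ⟨p, hN.ne_of_mem_pre_of_cLe hpt htc, hN.ne_of_mem_pre_of_cLe hpu hud,
          t, u, htu, hpt, hpu, htc, hud⟩
      by_cases hcd : c = d
      · subst hcd
        exact hN.not_conflict_inl_self c hconf
      · exact (hC c hc d hd hcd).2.2 hconf)
  refine ⟨M, hM, fun c hc => (hK.mem_iff c).2 ⟨fun t ht => ⟨c, hc, cLe_inr_inl ht⟩, ?_⟩⟩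
  rintro t hct ⟨d, hd, htd⟩
  have hcd : c ≠ d := fun hcd => hN.ne_of_mem_pre_of_cLe hct htd (by rw [hcd])
  exact (hC c hc d hd hcd).1 ((cLe_inl_inr hct).trans htd)

end IsOccurrence

end PetriNet

theorem IsBranchingProcess.reachable_map {P₁ T₁ P₂ T₂ : Type} [DecidableEq P₁] [DecidableEq P₂]
    {N₁ : PetriNet P₁ T₁} {N₂ : PetriNet P₂ T₂} {fP : P₁ → P₂} {fT : T₁ → T₂}
    (hbp : IsBranchingProcess N₁ N₂ fP fT) {M : Multiset P₁} (hM : N₁.Reachable M) :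
    N₂.Reachable (M.map fP) := by
  induction hM with
  | refl =>
    rw [hbp.map_init]
    exact .refl
  | tail _ hstep ih =>
    obtain ⟨t, ht, rfl⟩ := hstep
    obtain ⟨R, rfl⟩ := Multiset.le_iff_exists_add.1 ht
    refine ih.tail ⟨fT t, ?_, ?_⟩
    · simp [← hbp.map_pre]
    · simp [← hbp.map_pre, ← hbp.map_post]

/-- In an initial branching process of a bounded, finite net, the cuts are
exactly the reachable markings: every reachable marking is (the multiset of) a
cut, and every cut is a reachable marking. -/
theorem branchingProcess_cuts_eq_reachable {P₁ T₁ P₂ T₂ : Type}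
    [DecidableEq P₁] [DecidableEq P₂] [Finite P₂] [Finite T₂]
    (N₁ : PetriNet P₁ T₁) (N₂ : PetriNet P₂ T₂) (fP : P₁ → P₂) (fT : T₁ → T₂)
    (hbp : IsBranchingProcess N₁ N₂ fP fT)
    (hbounded : ∃ k : ℕ, 1 ≤ k ∧ ∀ M, N₂.Reachable M → ∀ p : P₂, M.count p ≤ k) :
    (∀ M : Multiset P₁, N₁.Reachable M → M.Nodup ∧ N₁.IsCut {p : P₁ | p ∈ M}) ∧
    (∀ C : Set P₁, N₁.IsCut C →
      ∃ M : Multiset P₁, N₁.Reachable M ∧ M.Nodup ∧ {p : P₁ | p ∈ M} = C) := by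
  have hN := hbp.occ
  refine ⟨fun M hM => ?_, fun C hC => ?_⟩
  · obtain ⟨K, hK⟩ := hN.exists_configuration hM
    exact ⟨hK.nodup, hK.isCut hN⟩
  · have hfin : C.Finite := by
      obtain ⟨k, -, hk⟩ := hbounded
      have := Fintype.ofFinite P₂
      by_contra hinf
      obtain ⟨F, hFC, hF⟩ :=
        Set.Infinite.exists_subset_card_eq hinf (Fintype.card P₂ * k + 1)
      obtain ⟨M, hM, hFM⟩ := hN.exists_reachable_superset F.finite_toSet
        fun p hp q hq => hC.1 p (hFC hp) q (hFC hq)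
      have hcard : F.card ≤ (M.map fP).card := by
        rw [Multiset.card_map]
        exact Multiset.card_le_card ((Multiset.le_iff_subset F.nodup).2 fun p hp => hFM hp)
      have hle : (M.map fP).card ≤ Fintype.card P₂ * k := by
        rw [← Multiset.sum_count_eq_card (s := Finset.univ) fun p _ => Finset.mem_univ p]
        exact (Finset.sum_le_card_nsmul _ _ k fun p _ => hk _ (hbp.reachable_map hM) p).trans_eq
          (by simp)
      omega
    obtain ⟨M, hM, hCM⟩ := hN.exists_reachable_superset hfin hC.1
    obtain ⟨K, hK⟩ := hN.exists_configuration hM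
    exact ⟨M, hM, hK.nodup, hC.2 _ hK.pairwiseConcurrent hCM⟩
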